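/- arXiv:1412.0815 — 3 statements merged into one kernel-verified Lean document; each statement's English description precedes it below -/
import Mathlib

section
/- Let (b,c) be a connected graph over a countably infinite set X and o ∈ X be fixed. Then D₀ is complete with respect to the norm ‖·‖_o; that is, (D₀, ⟨·,·⟩_o) with ⟨f,g⟩_o = Q(f,g) + f(o)g(o) is a Hilbert space. -/
open ENNReal Filter Topology

namespace UTGraph

variable {X : Type*}

/-- A graph over `X`: symmetric nonnegative edge weight `b` with zero diagonal and
summable rows, together with a nonnegative potential (killing term) `c`. -/
structure IsGraph (b : X → X → ℝ) (c : X → ℝ) : Prop where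
  symm : ∀ x y, b x y = b y x
  nonneg : ∀ x y, 0 ≤ b x y
  loopless : ∀ x, b x x = 0
  row_summable : ∀ x, Summable fun y => b x y
  c_nonneg : ∀ x, 0 ≤ c x

/-- Connectedness: any two vertices are joined by a path of positive edge weights. -/
def Connected (b : X → X → ℝ) : Prop :=
  ∀ x y : X, Relation.ReflTransGen (fun u v => 0 < b u v) x y

/-- The energy form `Q(f)`, with values in `[0,∞]`. -/
noncomputable def energy (b : X → X → ℝ) (c : X → ℝ) (f : X → ℝ) : ℝ≥0∞ :=
  (1 / 2) * ∑' p : X × X, ENNReal.ofReal (b p.1 p.2 * (f p.1 - f p.2) ^ 2)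
    + ∑' x, ENNReal.ofReal (c x * f x ^ 2)

/-- `f` has finite energy, i.e. `f ∈ D`. -/
def FiniteEnergy (b : X → X → ℝ) (c : X → ℝ) (f : X → ℝ) : Prop :=
  energy b c f < ⊤

/-- The bilinear energy form `Q(f,g)` (for finite-energy functions). -/
noncomputable def energyBilin (b : X → X → ℝ) (c : X → ℝ) (f g : X → ℝ) : ℝ :=
  (1 / 2) * ∑' p : X × X, b p.1 p.2 * (f p.1 - f p.2) * (g p.1 - g p.2)
    + ∑' x, c x * f x * g x

/-- `f ∈ C_c(X)`: finitely supported function. -/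
def FinSupp (f : X → ℝ) : Prop := (Function.support f).Finite

/-- The norm `‖f‖_o = (Q(f) + f(o)²)^{1/2}`. -/
noncomputable def normO (b : X → X → ℝ) (c : X → ℝ) (o : X) (f : X → ℝ) : ℝ :=
  Real.sqrt ((energy b c f).toReal + f o ^ 2)

/-- `f ∈ D₀`: there is a sequence of finitely supported functions converging to `f`
pointwise whose energy difference to `f` tends to `0`. -/
def MemD0 (b : X → X → ℝ) (c : X → ℝ) (f : X → ℝ) : Prop :=
  ∃ φ : ℕ → X → ℝ, (∀ n, FinSupp (φ n)) ∧
    (∀ x, Tendsto (fun n => φ n x) atTop (𝓝 (f x))) ∧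
    Tendsto (fun n => energy b c (φ n - f)) atTop (𝓝 0)

/-- `f ∈ C₀(X)`: `f` belongs to the uniform closure of the finitely supported functions,
i.e. for every `ε > 0` the set where `|f| ≥ ε` is finite. -/
def MemC0 (f : X → ℝ) : Prop := ∀ ε : ℝ, 0 < ε → {x | ε ≤ |f x|}.Finite

/-- The graph is uniformly transient: `D₀ ⊆ C₀(X)`. -/
def UniformlyTransient (b : X → X → ℝ) (c : X → ℝ) : Prop :=
  ∀ f : X → ℝ, MemD0 b c f → MemC0 f

/-- The capacity of a point: `cap(x) = inf {Q(φ) : φ ∈ C_c(X), φ(x) = 1}`. -/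
noncomputable def cap (b : X → X → ℝ) (c : X → ℝ) (x : X) : ℝ≥0∞ :=
  ⨅ (φ : X → ℝ) (_ : FinSupp φ) (_ : φ x = 1), energy b c φ

/-- `f ∈ F`: the domain of the formal Laplacian. -/
def MemF (b : X → X → ℝ) (f : X → ℝ) : Prop :=
  ∀ x, Summable fun y => b x y * |f y|

/-- The formal Laplacian `𝓛 f (x) = Σ_y b(x,y)(f(x) - f(y)) + c(x) f(x)`. -/
noncomputable def formalLaplacian (b : X → X → ℝ) (c : X → ℝ) (f : X → ℝ) (x : X) : ℝ :=
  (∑' y, b x y * (f x - f y)) + c x * f x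

/-- `f` is harmonic: `f ∈ F` and `𝓛 f = 0`. -/
def Harmonic (b : X → X → ℝ) (c : X → ℝ) (f : X → ℝ) : Prop :=
  MemF b f ∧ ∀ x, formalLaplacian b c f x = 0

/-- The graph is recurrent: the constant function `1` lies in `D₀` and `Q(1) = 0`. -/
def Recurrent (b : X → X → ℝ) (c : X → ℝ) : Prop :=
  MemD0 b c 1 ∧ energy b c 1 = 0

/-- The graph is transient: not recurrent. -/
def Transient (b : X → X → ℝ) (c : X → ℝ) : Prop := ¬ Recurrent b c

/-- The metric `γ_o`. -/
noncomputable def gammaO (b : X → X → ℝ) (c : X → ℝ) (o x y : X) : ℝ :=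
  sSup {d : ℝ | ∃ φ : X → ℝ, FinSupp φ ∧
    energy b c φ + ENNReal.ofReal (φ o ^ 2) ≤ 1 ∧ d = |φ x - φ y|}

/-- The metric `γ`. -/
noncomputable def gamma (b : X → X → ℝ) (c : X → ℝ) (x y : X) : ℝ :=
  sSup {d : ℝ | ∃ φ : X → ℝ, FinSupp φ ∧ energy b c φ ≤ 1 ∧ d = |φ x - φ y|}

/-- `d` is a metric on `X`. -/
def IsMetric (d : X → X → ℝ) : Prop :=
  (∀ x y, 0 ≤ d x y) ∧ (∀ x y, d x y = d y x) ∧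
  (∀ x y, d x y = 0 ↔ x = y) ∧ (∀ x y z, d x z ≤ d x y + d y z)

/-- `f` belongs to the closure of `C_c(X)` with respect to the norm
`‖·‖_Q = (Q(·) + ‖·‖_m²)^{1/2}` inside `D ∩ ℓ²(X,m)`. -/
def MemFormDomain (b : X → X → ℝ) (c : X → ℝ) (m : X → ℝ) (f : X → ℝ) : Prop :=
  FiniteEnergy b c f ∧ Summable (fun x => m x * f x ^ 2) ∧
  ∃ φ : ℕ → X → ℝ, (∀ n, FinSupp (φ n)) ∧
    Tendsto (fun n => energy b c (f - φ n)
      + ∑' x, ENNReal.ofReal (m x * (f x - φ n x) ^ 2)) atTop (𝓝 0)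

end UTGraph

namespace UTGraph

variable {X : Type*} {b : X → X → ℝ} {c : X → ℝ}

theorem ofReal_mul_add_sq_le {w : ℝ} (hw : 0 ≤ w) (s t : ℝ) :
    ENNReal.ofReal (w * (s + t) ^ 2) ≤
      2 * (ENNReal.ofReal (w * s ^ 2) + ENNReal.ofReal (w * t ^ 2)) := by
  rw [← ENNReal.ofReal_add (by positivity) (by positivity),
    show (2 : ℝ≥0∞) = ENNReal.ofReal 2 by simp, ← ENNReal.ofReal_mul (by norm_num)]
  apply ENNReal.ofReal_le_ofReal
  nlinarith [mul_nonneg hw (sq_nonneg (s - t))]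

theorem IsGraph.energy_add_le (hg : IsGraph b c) (f g : X → ℝ) :
    energy b c (f + g) ≤ 2 * (energy b c f + energy b c g) := by
  have hb : ∑' p : X × X, ENNReal.ofReal (b p.1 p.2 * ((f + g) p.1 - (f + g) p.2) ^ 2) ≤
      2 * (∑' p : X × X, ENNReal.ofReal (b p.1 p.2 * (f p.1 - f p.2) ^ 2) +
        ∑' p : X × X, ENNReal.ofReal (b p.1 p.2 * (g p.1 - g p.2) ^ 2)) := by
    rw [← ENNReal.tsum_add, ← ENNReal.tsum_mul_left]
    refine ENNReal.tsum_le_tsum fun p => ?_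
    rw [show (f + g) p.1 - (f + g) p.2 = (f p.1 - f p.2) + (g p.1 - g p.2) by
      simp only [Pi.add_apply]; ring]
    exact ofReal_mul_add_sq_le (hg.nonneg _ _) _ _
  have hc : ∑' x, ENNReal.ofReal (c x * (f + g) x ^ 2) ≤
      2 * (∑' x, ENNReal.ofReal (c x * f x ^ 2) + ∑' x, ENNReal.ofReal (c x * g x ^ 2)) := by
    rw [← ENNReal.tsum_add, ← ENNReal.tsum_mul_left]
    exact ENNReal.tsum_le_tsum fun x => ofReal_mul_add_sq_le (hg.c_nonneg _) _ _
  unfold energy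
  refine (add_le_add (mul_le_mul_right hb _) hc).trans (le_of_eq ?_)
  ring

theorem energy_sub_comm (f g : X → ℝ) : energy b c (f - g) = energy b c (g - f) := by
  unfold energy
  congr 3 <;> ext p <;> congr 1 <;> simp only [Pi.sub_apply] <;> ring

theorem IsGraph.energy_sub_le (hg : IsGraph b c) (f g h : X → ℝ) :
    energy b c (f - h) ≤ 2 * (energy b c (f - g) + energy b c (g - h)) := by
  simpa using hg.energy_add_le (f - g) (g - h)

theorem IsGraph.energy_lt_top_of_finSupp (hg : IsGraph b c) {φ : X → ℝ} (hφ : FinSupp φ) :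
    energy b c φ < ⊤ := by
  have key : ∀ w : X → ℝ≥0∞, (∀ x, w x < ⊤) →
      ∑' x, w x * ENNReal.ofReal (φ x ^ 2) < ⊤ := by
    intro w hw
    rw [tsum_eq_sum (s := hφ.toFinset)
      (fun x hx => by
        have : φ x = 0 := by
          by_contra hne
          exact hx (hφ.mem_toFinset.2 hne)
        simp [this])]
    exact ENNReal.sum_lt_top.2 fun x _ => ENNReal.mul_lt_top (hw x) ENNReal.ofReal_lt_top
  have hrow : ∑' p : X × X, ENNReal.ofReal (b p.1 p.2 * φ p.1 ^ 2) < ⊤ := by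
    rw [ENNReal.tsum_prod (f := fun x y => ENNReal.ofReal (b x y * φ x ^ 2))]
    simp_rw [ENNReal.ofReal_mul (hg.nonneg _ _), ENNReal.tsum_mul_right]
    exact key _ fun x => (hg.row_summable x).tsum_ofReal_lt_top
  have hcol : ∑' p : X × X, ENNReal.ofReal (b p.1 p.2 * (-φ p.2) ^ 2) < ⊤ := by
    rw [← (Equiv.prodComm X X).tsum_eq]
    simpa [hg.symm] using hrow
  have hb : ∑' p : X × X, ENNReal.ofReal (b p.1 p.2 * (φ p.1 - φ p.2) ^ 2) < ⊤ := by
    refine lt_of_le_of_lt (b := 2 * (∑' p : X × X, ENNReal.ofReal (b p.1 p.2 * φ p.1 ^ 2) +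
      ∑' p : X × X, ENNReal.ofReal (b p.1 p.2 * (-φ p.2) ^ 2))) ?_
      (ENNReal.mul_lt_top (by simp) (ENNReal.add_lt_top.2 ⟨hrow, hcol⟩))
    rw [← ENNReal.tsum_add, ← ENNReal.tsum_mul_left]
    refine ENNReal.tsum_le_tsum fun p => ?_
    rw [sub_eq_add_neg]
    exact ofReal_mul_add_sq_le (hg.nonneg _ _) _ _
  refine ENNReal.add_lt_top.2 ⟨ENNReal.mul_lt_top (by simp) hb, ?_⟩
  simp_rw [ENNReal.ofReal_mul (hg.c_nonneg _)]
  exact key _ fun x => ENNReal.ofReal_lt_top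

theorem IsGraph.energy_lt_top_of_memD0 (hg : IsGraph b c) {f : X → ℝ} (hf : MemD0 b c f) :
    energy b c f < ⊤ := by
  obtain ⟨φ, hφ, -, hlim⟩ := hf
  obtain ⟨n, hn⟩ := (hlim.eventually (gt_mem_nhds ENNReal.zero_lt_top)).exists
  rw [energy_sub_comm] at hn
  have h := hg.energy_add_le (f - φ n) (φ n)
  rw [sub_add_cancel] at h
  exact h.trans_lt (ENNReal.mul_lt_top (by simp)
    (ENNReal.add_lt_top.2 ⟨hn, hg.energy_lt_top_of_finSupp (hφ n)⟩))

theorem IsGraph.energy_sub_lt_top (hg : IsGraph b c) {f g : X → ℝ}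
    (hf : MemD0 b c f) (hg' : MemD0 b c g) : energy b c (f - g) < ⊤ := by
  have h := hg.energy_sub_le f 0 g
  rw [sub_zero, energy_sub_comm 0 g, sub_zero] at h
  exact h.trans_lt (ENNReal.mul_lt_top (by simp) (ENNReal.add_lt_top.2
    ⟨hg.energy_lt_top_of_memD0 hf, hg.energy_lt_top_of_memD0 hg'⟩))

theorem ofReal_edge_le_energy (f : X → ℝ) (u v : X) :
    ENNReal.ofReal (b u v * (f u - f v) ^ 2) ≤ 2 * energy b c f := by
  have h := ENNReal.le_tsum
    (f := fun p : X × X => ENNReal.ofReal (b p.1 p.2 * (f p.1 - f p.2) ^ 2)) (u, v)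
  refine h.trans ?_
  unfold energy
  rw [mul_add, ← mul_assoc, one_div, ENNReal.mul_inv_cancel (by simp) (by simp), one_mul]
  exact le_self_add

/-- Convergence to zero in energy and at one vertex forces pointwise convergence to zero. -/
theorem Connected.tendsto_apply_zero (hconn : Connected b) {ι : Type*} {l : Filter ι}
    {h : ι → X → ℝ} {o : X} (henergy : Tendsto (fun i => energy b c (h i)) l (𝓝 0))
    (ho : Tendsto (fun i => h i o) l (𝓝 0)) (x : X) :
    Tendsto (fun i => h i x) l (𝓝 0) := by
  induction hconn o x with
  | refl => exact ho
  | @tail u v _ huv ih =>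
    have h2 : Tendsto (fun i => 2 * energy b c (h i)) l (𝓝 0) := by
      simpa using ENNReal.Tendsto.const_mul henergy (Or.inr (ENNReal.ofNat_ne_top (n := 2)))
    have hedge : Tendsto (fun i => ENNReal.ofReal (b u v * (h i u - h i v) ^ 2)) l (𝓝 0) :=
      tendsto_of_tendsto_of_tendsto_of_le_of_le tendsto_const_nhds h2
        (fun _ => zero_le) (fun i => ofReal_edge_le_energy (h i) u v)
    have hreal : Tendsto (fun i => b u v * (h i u - h i v) ^ 2) l (𝓝 0) := by
      have := (ENNReal.tendsto_toReal ENNReal.zero_ne_top).comp hedge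
      refine this.congr fun i => ENNReal.toReal_ofReal ?_
      exact mul_nonneg huv.le (sq_nonneg _)
    have hsq : Tendsto (fun i => |h i u - h i v|) l (𝓝 0) := by
      have := (hreal.const_mul (b u v)⁻¹).sqrt
      simpa [inv_mul_cancel_left₀ huv.ne', Real.sqrt_sq_eq_abs] using this
    simpa using ih.sub ((tendsto_zero_iff_abs_tendsto_zero _).2 hsq)

theorem lowerSemicontinuous_energy : LowerSemicontinuous (energy b c) := by
  unfold energy
  simp_rw [← ENNReal.tsum_mul_left]
  refine LowerSemicontinuous.add (lowerSemicontinuous_tsum fun p => ?_)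
    (lowerSemicontinuous_tsum fun x => ?_)
  · refine Continuous.lowerSemicontinuous ?_
    exact (ENNReal.continuous_const_mul (by simp)).comp
      (ENNReal.continuous_ofReal.comp (by fun_prop))
  · exact Continuous.lowerSemicontinuous (ENNReal.continuous_ofReal.comp (by fun_prop))

theorem tendsto_zero_of_tendsto_normO {ι : Type*} {l : Filter ι} {h : ι → X → ℝ} {o : X}
    (hfin : ∀ i, energy b c (h i) < ⊤) (hnorm : Tendsto (fun i => normO b c o (h i)) l (𝓝 0)) :
    Tendsto (fun i => energy b c (h i)) l (𝓝 0) ∧ Tendsto (fun i => h i o) l (𝓝 0) := by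
  have hsq : Tendsto (fun i => (energy b c (h i)).toReal + h i o ^ 2) l (𝓝 0) := by
    have := hnorm.pow 2
    simp only [normO, ne_eq, OfNat.ofNat_ne_zero, not_false_eq_true, zero_pow] at this
    exact this.congr fun i => Real.sq_sqrt (by positivity)
  constructor
  · rw [← ENNReal.tendsto_toReal_iff (fun i => (hfin i).ne) ENNReal.zero_ne_top]
    exact squeeze_zero (fun _ => ENNReal.toReal_nonneg)
      (fun i => le_add_of_nonneg_right (sq_nonneg _)) hsq
  · have h2 : Tendsto (fun i => h i o ^ 2) l (𝓝 0) :=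
      squeeze_zero (fun _ => sq_nonneg _)
        (fun i => le_add_of_nonneg_left ENNReal.toReal_nonneg) hsq
    rw [tendsto_zero_iff_abs_tendsto_zero]
    have := h2.sqrt
    simp only [Real.sqrt_sq_eq_abs, Real.sqrt_zero] at this
    exact this

theorem tendsto_normO_zero {ι : Type*} {l : Filter ι} {h : ι → X → ℝ} {o : X}
    (henergy : Tendsto (fun i => energy b c (h i)) l (𝓝 0))
    (ho : Tendsto (fun i => h i o) l (𝓝 0)) :
    Tendsto (fun i => normO b c o (h i)) l (𝓝 0) := by
  have h1 := (ENNReal.tendsto_toReal ENNReal.zero_ne_top).comp henergy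
  simpa [normO] using (h1.add (ho.pow 2)).sqrt

/-- A function that is the limit, in energy and at one vertex, of elements of `D₀` is in `D₀`. -/
theorem IsGraph.memD0_of_tendsto (hg : IsGraph b c) (hconn : Connected b) {o : X}
    {f : ℕ → X → ℝ} {g : X → ℝ} (hf : ∀ n, MemD0 b c (f n))
    (henergy : Tendsto (fun n => energy b c (f n - g)) atTop (𝓝 0))
    (ho : Tendsto (fun n => f n o) atTop (𝓝 (g o))) : MemD0 b c g := by
  have happrox : ∀ n : ℕ, ∃ φ : X → ℝ, FinSupp φ ∧
      energy b c (φ - f n) < ((n : ℝ≥0∞) + 1)⁻¹ ∧ |φ o - f n o| < 1 / ((n : ℝ) + 1) := by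
    intro n
    obtain ⟨φ, hφ, hpt, hlim⟩ := hf n
    have h1 := hlim.eventually (gt_mem_nhds (ENNReal.inv_pos.2
      (ENNReal.add_ne_top.2 ⟨ENNReal.natCast_ne_top n, ENNReal.one_ne_top⟩)))
    have h2 := (hpt o).eventually
      (Metric.ball_mem_nhds (f n o) (ε := 1 / ((n : ℝ) + 1)) (by positivity))
    obtain ⟨k, hk1, hk2⟩ := (h1.and h2).exists
    exact ⟨φ k, hφ k, hk1, by simpa [Real.dist_eq] using hk2⟩
  choose φ hφ hφenergy hφo using happrox
  have hsmall : Tendsto (fun n => energy b c (φ n - f n)) atTop (𝓝 0) := by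
    have : Tendsto (fun n : ℕ => ((n : ℝ≥0∞) + 1)⁻¹) atTop (𝓝 0) := by
      simpa [Function.comp_def] using
        ENNReal.tendsto_inv_nat_nhds_zero.comp (tendsto_add_atTop_nat 1)
    exact tendsto_of_tendsto_of_tendsto_of_le_of_le tendsto_const_nhds this
      (fun _ => zero_le) (fun n => (hφenergy n).le)
  have hφg : Tendsto (fun n => energy b c (φ n - g)) atTop (𝓝 0) := by
    have h2 : Tendsto (fun n => 2 * (energy b c (φ n - f n) + energy b c (f n - g)))
        atTop (𝓝 0) := by
      simpa using ENNReal.Tendsto.const_mul (hsmall.add henergy)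
        (Or.inr (ENNReal.ofNat_ne_top (n := 2)))
    exact tendsto_of_tendsto_of_tendsto_of_le_of_le tendsto_const_nhds h2
      (fun _ => zero_le) (fun n => hg.energy_sub_le _ _ _)
  have hφgo : Tendsto (fun n => (φ n - g) o) atTop (𝓝 0) := by
    have h1 : Tendsto (fun n => φ n o - f n o) atTop (𝓝 0) :=
      (tendsto_zero_iff_abs_tendsto_zero _).2 (squeeze_zero (fun _ => abs_nonneg _)
        (fun n => (hφo n).le) tendsto_one_div_add_atTop_nhds_zero_nat)
    simpa using h1.add (ho.sub_const (g o))
  refine ⟨φ, hφ, fun x => ?_, hφg⟩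
  exact tendsto_sub_nhds_zero_iff.1 (hconn.tendsto_apply_zero hφg hφgo x)

end UTGraph

open UTGraph Filter Topology ENNReal in
/-- `D₀` is complete with respect to the norm `‖·‖_o`: every
`‖·‖_o`-Cauchy sequence in `D₀` converges in norm to an element of `D₀`. -/
theorem stmt2 {X : Type*} [Countable X] [Infinite X]
    (b : X → X → ℝ) (c : X → ℝ) (hgraph : IsGraph b c) (hconn : Connected b)
    (o : X) :
    ∀ f : ℕ → X → ℝ, (∀ n, MemD0 b c (f n)) →
      (∀ ε : ℝ, 0 < ε → ∃ N : ℕ, ∀ k l, N ≤ k → N ≤ l → normO b c o (f k - f l) < ε) →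
      ∃ g : X → ℝ, MemD0 b c g ∧
        Tendsto (fun n => normO b c o (f n - g)) atTop (𝓝 0) := by
  intro f hf hcauchy
  have hnorm : Tendsto (fun p : ℕ × ℕ => normO b c o (f p.1 - f p.2)) atTop (𝓝 0) := by
    refine Metric.tendsto_atTop.2 fun ε hε => ?_
    obtain ⟨N, hN⟩ := hcauchy ε hε
    refine ⟨(N, N), fun p hp => ?_⟩
    have hnonneg : 0 ≤ normO b c o (f p.1 - f p.2) := Real.sqrt_nonneg _
    rw [Real.dist_0_eq_abs, abs_of_nonneg hnonneg]
    exact hN p.1 p.2 hp.1 hp.2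
  obtain ⟨henergy, ho⟩ := tendsto_zero_of_tendsto_normO (h := fun p : ℕ × ℕ => f p.1 - f p.2)
    (fun p => hgraph.energy_sub_lt_top (hf p.1) (hf p.2)) hnorm
  have hlim : ∀ x, ∃ a, Tendsto (fun n => f n x) atTop (𝓝 a) := fun x =>
    cauchySeq_tendsto_of_complete <| cauchySeq_iff_tendsto_dist_atTop_0.2 <| by
      simpa [Real.dist_eq] using (hconn.tendsto_apply_zero henergy ho x).abs
  choose g hg using hlim
  have hfg : Tendsto (fun n => energy b c (f n - g)) atTop (𝓝 0) := by
    refine ENNReal.tendsto_atTop_zero.2 fun ε hε => ?_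
    obtain ⟨⟨N, M⟩, hN⟩ := ENNReal.tendsto_atTop_zero.1 henergy ε hε
    refine ⟨N, fun n hn => ?_⟩
    have hpt : Tendsto (fun k => f n - f k) atTop (𝓝 (f n - g)) :=
      tendsto_pi_nhds.2 fun x => (hg x).const_sub (f n x)
    have hle : ∀ᶠ k in atTop, f n - f k ∈ energy b c ⁻¹' Set.Iic ε :=
      eventually_atTop.2 ⟨M, fun k hk => hN (n, k) ⟨hn, hk⟩⟩
    exact (lowerSemicontinuous_energy.isClosed_preimage ε).mem_of_tendsto hpt hle
  refine ⟨g, hgraph.memD0_of_tendsto hconn hf hfg (hg o), tendsto_normO_zero hfg ?_⟩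
  simpa using (hg o).sub_const (g o)
end

section
/- Let (b,c) be a connected graph over a countably infinite set X. Then for every normal contraction C : ℝ → ℝ (i.e. |C(s) − C(t)| ≤ |s − t| and |C(s)| ≤ |s| for all s,t ∈ ℝ) and every f ∈ D₀, the composition C ∘ f belongs to D₀. -/
open ENNReal Filter Topology

namespace UTGraph

open Filter Topology ENNReal

/-- Generalized dominated convergence for sums in `[0,∞]`: the dominating sequence may be a
fixed summable function plus a sequence whose sums tend to zero. -/
theorem tendsto_tsum_zero_of_le_add {ι : Type*} {u a : ℕ → ι → ℝ≥0∞} {h : ι → ℝ≥0∞}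
    (ha : Tendsto (fun n => ∑' i, a n i) atTop (𝓝 0)) (hh : ∑' i, h i ≠ ⊤)
    (hle : ∀ n i, u n i ≤ a n i + h i) (hu : ∀ i, Tendsto (fun n => u n i) atTop (𝓝 0)) :
    Tendsto (fun n => ∑' i, u n i) atTop (𝓝 0) := by
  let _ : MeasurableSpace ι := ⊤
  have hmin : Tendsto (fun n => ∑' i, min (u n i) (h i)) atTop (𝓝 0) := by
    have key := MeasureTheory.tendsto_lintegral_of_dominated_convergence
      (μ := MeasureTheory.Measure.count) (F := fun n i => min (u n i) (h i))
      (f := fun _ => (0 : ℝ≥0∞)) h (fun n => measurable_from_top)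
      (fun n => Eventually.of_forall fun i => min_le_right _ _)
      (by rwa [MeasureTheory.lintegral_count])
      (Eventually.of_forall fun i => tendsto_of_tendsto_of_tendsto_of_le_of_le
        tendsto_const_nhds (hu i) (fun _ => zero_le) (fun _ => min_le_left _ _))
    simpa [MeasureTheory.lintegral_count] using key
  have hsum := ha.add hmin
  rw [add_zero] at hsum
  refine tendsto_of_tendsto_of_tendsto_of_le_of_le tendsto_const_nhds hsum
    (fun _ => zero_le) (fun n => ?_)
  change ∑' i, u n i ≤ ∑' i, a n i + ∑' i, min (u n i) (h i)
  rw [← ENNReal.tsum_add]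
  refine ENNReal.tsum_le_tsum fun i => ?_
  rcases le_total (u n i) (h i) with hi | hi
  · rw [min_eq_left hi]
    exact le_add_self
  · rw [min_eq_right hi]
    exact hle n i

theorem ofReal_mul_sq_le {w r s t : ℝ} {A B : ℝ} (hw : 0 ≤ w) (hA : 0 ≤ A) (hB : 0 ≤ B)
    (h : r ^ 2 ≤ A * s ^ 2 + B * t ^ 2) :
    ENNReal.ofReal (w * r ^ 2) ≤
      ENNReal.ofReal A * ENNReal.ofReal (w * s ^ 2)
        + ENNReal.ofReal B * ENNReal.ofReal (w * t ^ 2) := by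
  rw [← ENNReal.ofReal_mul hA, ← ENNReal.ofReal_mul hB,
    ← ENNReal.ofReal_add (by positivity) (by positivity)]
  exact ENNReal.ofReal_le_ofReal (by nlinarith [mul_le_mul_of_nonneg_left h hw])

/-- In a weighted `ℓ²` space, pointwise convergence `k n → k` upgrades to norm convergence when
`k n`, `k` are dominated by `g n`, `g` and `g n → g` in norm. -/
theorem tendsto_weighted_sq_of_dominated {ι : Type*} {w : ι → ℝ} (hw : ∀ i, 0 ≤ w i)
    {g' k' : ℕ → ι → ℝ} {g k : ι → ℝ}
    (hk' : ∀ n i, |k' n i| ≤ |g' n i|) (hk : ∀ i, |k i| ≤ |g i|)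
    (hlim : ∀ i, Tendsto (fun n => k' n i) atTop (𝓝 (k i)))
    (hfin : ∀ n, ∑' i, ENNReal.ofReal (w i * g' n i ^ 2) ≠ ⊤)
    (hg : Tendsto (fun n => ∑' i, ENNReal.ofReal (w i * (g' n i - g i) ^ 2)) atTop (𝓝 0)) :
    Tendsto (fun n => ∑' i, ENNReal.ofReal (w i * (k' n i - k i) ^ 2)) atTop (𝓝 0) := by
  have hgfin : ∑' i, ENNReal.ofReal (w i * g i ^ 2) ≠ ⊤ := by
    obtain ⟨n, hn⟩ := (hg.eventually_lt_const ENNReal.zero_lt_top).exists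
    refine ne_top_of_le_ne_top ?_ (ENNReal.tsum_le_tsum fun i =>
      ofReal_mul_sq_le (A := 2) (B := 2) (s := g' n i - g i) (t := g' n i) (hw i)
        (by norm_num) (by norm_num) (by nlinarith [sq_nonneg (g i - 2 * g' n i)]))
    rw [ENNReal.tsum_add, ENNReal.tsum_mul_left, ENNReal.tsum_mul_left]
    exact ENNReal.add_ne_top.2 ⟨ENNReal.mul_ne_top ENNReal.ofReal_ne_top hn.ne,
      ENNReal.mul_ne_top ENNReal.ofReal_ne_top (hfin n)⟩
  refine tendsto_tsum_zero_of_le_add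
    (a := fun n i => ENNReal.ofReal 4 * ENNReal.ofReal (w i * (g' n i - g i) ^ 2))
    (h := fun i => ENNReal.ofReal 6 * ENNReal.ofReal (w i * g i ^ 2)) ?_ ?_ ?_ ?_
  · simp_rw [ENNReal.tsum_mul_left]
    simpa using ENNReal.Tendsto.const_mul hg (Or.inr (ENNReal.ofReal_ne_top (r := 4)))
  · rw [ENNReal.tsum_mul_left]
    exact ENNReal.mul_ne_top ENNReal.ofReal_ne_top hgfin
  · intro n i
    refine ofReal_mul_sq_le (hw i) (by norm_num) (by norm_num) ?_
    nlinarith [sq_le_sq.2 (hk' n i), sq_le_sq.2 (hk i), sq_nonneg (k' n i + k i),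
      sq_nonneg (g' n i - 2 * g i)]
  · intro i
    have hreal : Tendsto (fun n => w i * (k' n i - k i) ^ 2) atTop (𝓝 0) := by
      simpa using (((hlim i).sub_const (k i)).pow 2).const_mul (w i)
    simpa using ENNReal.tendsto_ofReal hreal

theorem IsGraph.tsum_edge_left_ne_top {X : Type*} {b : X → X → ℝ} {c : X → ℝ}
    (hgraph : IsGraph b c) {φ : X → ℝ} (hφ : FinSupp φ) :
    ∑' p : X × X, ENNReal.ofReal (b p.1 p.2 * φ p.1 ^ 2) ≠ ⊤ := by
  rw [ENNReal.tsum_prod', tsum_eq_sum (s := hφ.toFinset)]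
  · refine ENNReal.sum_ne_top.2 fun x _ => ?_
    exact ((hgraph.row_summable x).mul_right (φ x ^ 2)).tsum_ofReal_ne_top
  · intro x hx
    have hx0 : φ x = 0 := by
      by_contra hne
      exact hx (hφ.mem_toFinset.2 hne)
    simp [hx0]

theorem IsGraph.tsum_edge_ne_top {X : Type*} {b : X → X → ℝ} {c : X → ℝ}
    (hgraph : IsGraph b c) {φ : X → ℝ} (hφ : FinSupp φ) :
    ∑' p : X × X, ENNReal.ofReal (b p.1 p.2 * (φ p.1 - φ p.2) ^ 2) ≠ ⊤ := by
  have hleft := hgraph.tsum_edge_left_ne_top hφ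
  have hright : ∑' p : X × X, ENNReal.ofReal (b p.1 p.2 * φ p.2 ^ 2) ≠ ⊤ := by
    rw [← (Equiv.prodComm X X).tsum_eq]
    simpa [hgraph.symm] using hleft
  refine ne_top_of_le_ne_top ?_ (ENNReal.tsum_le_tsum fun p =>
    ofReal_mul_sq_le (A := 2) (B := 2) (s := φ p.1) (t := φ p.2) (hgraph.nonneg _ _)
      (by norm_num) (by norm_num) (by nlinarith [sq_nonneg (φ p.1 + φ p.2)]))
  rw [ENNReal.tsum_add, ENNReal.tsum_mul_left, ENNReal.tsum_mul_left]
  exact ENNReal.add_ne_top.2 ⟨ENNReal.mul_ne_top ENNReal.ofReal_ne_top hleft,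
    ENNReal.mul_ne_top ENNReal.ofReal_ne_top hright⟩

theorem tsum_killing_ne_top {X : Type*} (c : X → ℝ) {φ : X → ℝ} (hφ : FinSupp φ) :
    ∑' x, ENNReal.ofReal (c x * φ x ^ 2) ≠ ⊤ := by
  rw [tsum_eq_sum (s := hφ.toFinset)]
  · exact ENNReal.sum_ne_top.2 fun x _ => ENNReal.ofReal_ne_top
  · intro x hx
    have hx0 : φ x = 0 := by
      by_contra hne
      exact hx (hφ.mem_toFinset.2 hne)
    simp [hx0]

theorem tendsto_energy_zero_iff {X : Type*} {b : X → X → ℝ} {c : X → ℝ} {g : ℕ → X → ℝ} :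
    Tendsto (fun n => energy b c (g n)) atTop (𝓝 0) ↔
      Tendsto (fun n => ∑' p : X × X, ENNReal.ofReal (b p.1 p.2 * (g n p.1 - g n p.2) ^ 2))
        atTop (𝓝 0) ∧
      Tendsto (fun n => ∑' x, ENNReal.ofReal (c x * g n x ^ 2)) atTop (𝓝 0) := by
  constructor
  · intro h
    constructor
    · have h2 := ENNReal.Tendsto.const_mul h (Or.inr (ENNReal.ofNat_ne_top (n := 2)))
      rw [mul_zero] at h2
      refine tendsto_of_tendsto_of_tendsto_of_le_of_le tendsto_const_nhds h2
        (fun _ => zero_le) (fun n => ?_)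
      dsimp only [energy]
      rw [mul_add, ← mul_assoc, one_div,
        ENNReal.mul_inv_cancel two_ne_zero ENNReal.ofNat_ne_top, one_mul]
      exact le_self_add
    · exact tendsto_of_tendsto_of_tendsto_of_le_of_le tendsto_const_nhds h
        (fun _ => zero_le) (fun n => le_add_self)
  · rintro ⟨h1, h2⟩
    simpa [energy] using (ENNReal.Tendsto.const_mul (a := 1 / 2) h1 (Or.inr (by simp))).add h2

end UTGraph

open UTGraph Filter Topology ENNReal in
/-- for a connected graph, `D₀` is stable under normal contractions. -/
theorem stmt3 {X : Type*} [Countable X] [Infinite X]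
    (b : X → X → ℝ) (c : X → ℝ) (hgraph : IsGraph b c) (hconn : Connected b)
    (C : ℝ → ℝ) (hC1 : ∀ s t : ℝ, |C s - C t| ≤ |s - t|) (hC2 : ∀ s : ℝ, |C s| ≤ |s|)
    (f : X → ℝ) (hf : MemD0 b c f) :
    MemD0 b c (C ∘ f) := by
  obtain ⟨φ, hφ, hlim, hen⟩ := hf
  have hC0 : C 0 = 0 := by simpa using hC2 0
  have hCcont : Continuous C := (LipschitzWith.of_dist_le_mul (K := 1) fun s t => by
    simpa [Real.dist_eq] using hC1 s t).continuous
  have hClim : ∀ x, Tendsto (fun n => C (φ n x)) atTop (𝓝 (C (f x))) := fun x =>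
    (hCcont.tendsto _).comp (hlim x)
  obtain ⟨hedge, hkill⟩ := tendsto_energy_zero_iff.1 hen
  refine ⟨fun n => C ∘ φ n, fun n => (hφ n).subset (Function.support_comp_subset hC0 _),
    hClim, tendsto_energy_zero_iff.2 ⟨?_, ?_⟩⟩
  · simp only [Pi.sub_apply, sub_sub_sub_comm _ (f _)] at hedge
    simp only [Pi.sub_apply, Function.comp_apply, sub_sub_sub_comm _ (C (f _))]
    exact tendsto_weighted_sq_of_dominated (w := fun p : X × X => b p.1 p.2)
      (g' := fun n p => φ n p.1 - φ n p.2) (g := fun p => f p.1 - f p.2)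
      (k' := fun n p => C (φ n p.1) - C (φ n p.2)) (k := fun p => C (f p.1) - C (f p.2))
      (fun p => hgraph.nonneg _ _) (fun n p => hC1 _ _) (fun p => hC1 _ _)
      (fun p => (hClim p.1).sub (hClim p.2)) (fun n => hgraph.tsum_edge_ne_top (hφ n)) hedge
  · exact tendsto_weighted_sq_of_dominated hgraph.c_nonneg (fun n x => hC2 _) (fun x => hC2 _)
      hClim (fun n => tsum_killing_ne_top c (hφ n)) hkill
end

section
/- Let X be a countably infinite set and (b,c) a connected canonically compactifiable graph over X, i.e. every function of finite energy is bounded. Then (b,c) is uniformly transient, i.e. D₀ ⊆ C₀(X). -/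
open ENNReal Filter Topology

namespace UTGraph

variable {X : Type*}

lemma ofReal_mul_ciSup_sub_sq_le {a : ℝ} (ha : 0 ≤ a) {u v : ℕ → ℝ}
    (hu : BddAbove (Set.range u)) (hv : BddAbove (Set.range v)) :
    ENNReal.ofReal (a * ((⨆ k, u k) - ⨆ k, v k) ^ 2)
      ≤ ∑' k, ENNReal.ofReal (a * (u k - v k) ^ 2) := by
  rcases ha.eq_or_lt with rfl | ha
  · simp
  set S := ∑' k, ENNReal.ofReal (a * (u k - v k) ^ 2) with hS
  by_cases hT : S = ⊤
  · simp [hT]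
  have hk (k : ℕ) : |u k - v k| ≤ √(S.toReal / a) := by
    apply Real.abs_le_sqrt
    rw [le_div_iff₀ ha, mul_comm]
    exact (ENNReal.ofReal_le_iff_le_toReal hT).1 (ENNReal.le_tsum k)
  have h₁ : (⨆ k, u k) ≤ (⨆ k, v k) + √(S.toReal / a) :=
    ciSup_le fun k => by linarith [le_ciSup hv k, (abs_le.1 (hk k)).2]
  have h₂ : (⨆ k, v k) ≤ (⨆ k, u k) + √(S.toReal / a) :=
    ciSup_le fun k => by linarith [le_ciSup hu k, (abs_le.1 (hk k)).1]
  rw [ENNReal.ofReal_le_iff_le_toReal hT, mul_comm, ← le_div_iff₀ ha,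
    ← Real.sq_sqrt (show 0 ≤ S.toReal / a by positivity)]
  exact sq_le_sq' (by linarith) (by linarith)

lemma energy_ciSup_le {b : X → X → ℝ} {c : X → ℝ} (hgraph : IsGraph b c)
    {G : ℕ → X → ℝ} (hG : ∀ x, BddAbove (Set.range fun k => G k x)) :
    energy b c (fun x => ⨆ k, G k x) ≤ ∑' k, energy b c (G k) := by
  unfold energy
  rw [ENNReal.tsum_add, ENNReal.tsum_mul_left, ENNReal.tsum_comm (α := ℕ) (β := X × X),
    ENNReal.tsum_comm (α := ℕ) (β := X)]
  gcongr with p x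
  · exact ofReal_mul_ciSup_sub_sq_le (hgraph.nonneg _ _) (hG _) (hG _)
  · simpa using ofReal_mul_ciSup_sub_sq_le (hgraph.c_nonneg x) (hG x)
      (v := fun _ => 0) (by simp)

lemma energy_mul_abs_le {b : X → X → ℝ} {c : X → ℝ} (hgraph : IsGraph b c)
    (t : ℝ) (g : X → ℝ) :
    energy b c (fun x => t * |g x|) ≤ ENNReal.ofReal (t ^ 2) * energy b c g := by
  unfold energy
  rw [mul_add, mul_left_comm, ← ENNReal.tsum_mul_left (a := ENNReal.ofReal (t ^ 2)),
    ← ENNReal.tsum_mul_left (a := ENNReal.ofReal (t ^ 2))]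
  simp_rw [← ENNReal.ofReal_mul (sq_nonneg t)]
  refine add_le_add
    (mul_le_mul' le_rfl (ENNReal.tsum_le_tsum fun p => ENNReal.ofReal_le_ofReal ?_))
    (ENNReal.tsum_le_tsum fun x => ENNReal.ofReal_le_ofReal ?_)
  · have h : (|g p.1| - |g p.2|) ^ 2 ≤ (g p.1 - g p.2) ^ 2 :=
      sq_le_sq.2 (abs_abs_sub_abs_le _ _)
    calc b p.1 p.2 * (t * |g p.1| - t * |g p.2|) ^ 2
        = t ^ 2 * (b p.1 p.2 * (|g p.1| - |g p.2|) ^ 2) := by ring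
      _ ≤ _ := by
        have := hgraph.nonneg p.1 p.2
        gcongr
  · rw [mul_pow, sq_abs]
    exact (mul_left_comm _ _ _).le

/-- On a canonically compactifiable graph, pointwise convergence to zero together with
convergence of the energies to zero implies uniform convergence to zero. -/
lemma eventually_forall_abs_lt [Countable X] {b : X → X → ℝ} {c : X → ℝ}
    (hgraph : IsGraph b c)
    (hcc : ∀ f : X → ℝ, FiniteEnergy b c f → ∃ M : ℝ, ∀ x, |f x| ≤ M)
    {g : ℕ → X → ℝ} (hg : ∀ x, Tendsto (fun n => g n x) atTop (𝓝 0))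
    (hQ : Tendsto (fun n => energy b c (g n)) atTop (𝓝 0)) {ε : ℝ} (hε : 0 < ε) :
    ∀ᶠ n in atTop, ∀ x, |g n x| < ε := by
  by_contra hne
  rw [not_eventually] at hne
  push Not at hne
  obtain ⟨e, he⟩ := exists_injective_nat X
  have hstep (k : ℕ) : ∃ n, (∃ x, ε ≤ |g n x|) ∧ (∀ x ∈ e ⁻¹' Set.Iic k, k * |g n x| ≤ 1) ∧
      ENNReal.ofReal ((k : ℝ) ^ 2) * energy b c (g n) ≤ 2⁻¹ ^ k := by
    refine (hne.and_eventually (.and ?_ ?_)).exists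
    · rw [eventually_all_finite ((Set.finite_Iic k).preimage he.injOn)]
      intro x _
      have h := ((hg x).abs.const_mul (k : ℝ))
      rw [abs_zero, mul_zero] at h
      exact h.eventually_le_const one_pos
    · have h := ENNReal.Tendsto.const_mul (a := ENNReal.ofReal ((k : ℝ) ^ 2)) hQ
        (.inr ENNReal.ofReal_ne_top)
      rw [mul_zero] at h
      exact h.eventually_le_const (ENNReal.pow_pos (by simp) k)
  choose n hlarge hsmall henergy using hstep
  have hbdd (x : X) : BddAbove (Set.range fun k : ℕ => (k : ℝ) * |g (n k) x|) := by
    refine IsBoundedUnder.bddAbove_range (isBoundedUnder_of_eventually_le (a := 1) ?_)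
    filter_upwards [eventually_ge_atTop (e x)] with k hk using hsmall k x hk
  have hfin : FiniteEnergy b c fun x => ⨆ k : ℕ, (k : ℝ) * |g (n k) x| := by
    refine (energy_ciSup_le hgraph hbdd).trans_lt ?_
    calc ∑' k : ℕ, energy b c (fun x => (k : ℝ) * |g (n k) x|)
        ≤ ∑' k : ℕ, (2⁻¹ : ℝ≥0∞) ^ k :=
          ENNReal.tsum_le_tsum fun k => (energy_mul_abs_le hgraph _ _).trans (henergy k)
      _ < ⊤ := by rw [ENNReal.tsum_geometric, ENNReal.one_sub_inv_two]; simp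
  obtain ⟨M, hM⟩ := hcc _ hfin
  obtain ⟨k, hk⟩ := exists_nat_gt (M / ε)
  obtain ⟨x, hx⟩ := hlarge k
  rw [div_lt_iff₀ hε] at hk
  have h₁ : (k : ℝ) * ε ≤ k * |g (n k) x| := by gcongr
  linarith [le_ciSup (hbdd x) k, (le_abs_self _).trans (hM x)]

end UTGraph

open UTGraph Filter Topology ENNReal in
/-- a connected canonically compactifiable graph (every function of
finite energy is bounded) is uniformly transient. -/
theorem stmt8 {X : Type*} [Countable X] [Infinite X]
    (b : X → X → ℝ) (c : X → ℝ) (hgraph : IsGraph b c) (hconn : Connected b)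
    (hcc : ∀ f : X → ℝ, FiniteEnergy b c f → ∃ M : ℝ, ∀ x, |f x| ≤ M) :
    UniformlyTransient b c := by
  rintro f ⟨φ, hφ, hlim, hQ⟩ ε hε
  obtain ⟨n, hn⟩ := (eventually_forall_abs_lt (g := fun n => φ n - f) hgraph hcc
    (fun x => by simpa using (hlim x).sub_const (f x)) hQ hε).exists
  refine (hφ n).subset fun x hx h0 => ?_
  have h := hn x
  rw [Pi.sub_apply, h0, zero_sub, abs_neg] at h
  exact h.not_ge hx
end
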